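/- Let q ∈ 𝕊 and suppose P ∈ 𝕊[x] is written as P(x) = Q(x) Ψ_q(x) + B x + A with Q ∈ 𝕊[x] and A, B ∈ 𝕊. Assume det(B) ≠ 0 and that Ψ_q divides the companion polynomial C_P = conj(P) P in 𝕊[x]. Then z₀ := −B̄ A / det(B) (= −B⁻¹A) satisfies re(z₀) = re(q), det(z₀) = det(q) and P(z₀) = 0; moreover z₀ is the unique zero of P quasi-similar to q. -/

import Mathlib

open Quaternion Polynomial

noncomputable section

/-- The real algebra of coquaternions (split quaternions):
basis `1, i, j, k` with `i² = -1`, `j² = k² = 1`, `ij = -ji = k`. -/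
abbrev CoQ : Type := ℍ[ℝ, -1, 1]

/-- The determinant of a coquaternion: `det q = q₀² + q₁² - q₂² - q₃²` (equals `q * star q`). -/
def coDet (q : CoQ) : ℝ := q.re ^ 2 + q.imI ^ 2 - q.imJ ^ 2 - q.imK ^ 2

/-- The conjugate polynomial: coefficients are conjugated (`star`) coefficientwise. -/
def pconj (P : Polynomial CoQ) : Polynomial CoQ := ⟨.ofCoeff (P.toFinsupp.coeff.mapRange star (star_zero _))⟩

/-- The characteristic polynomial of the quasi-similarity class of `q`:
`Ψ_q(x) = x² - 2 re(q) x + det(q)`, a polynomial with real coefficients. -/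
def charPoly (q : CoQ) : Polynomial CoQ :=
  X ^ 2 - C ((2 * q.re : ℝ) : CoQ) * X + C ((coDet q : ℝ) : CoQ)

lemma coeff_pconj (P : Polynomial CoQ) (n : ℕ) : (pconj P).coeff n = star (P.coeff n) := rfl

lemma pconj_add (P Q : Polynomial CoQ) : pconj (P + Q) = pconj P + pconj Q := by
  ext1 n
  simp only [coeff_pconj, coeff_add, star_add]

lemma pconj_mul (P Q : Polynomial CoQ) : pconj (P * Q) = pconj Q * pconj P := by
  ext1 n
  rw [coeff_pconj, coeff_mul, coeff_mul, star_sum, ← Finset.Nat.sum_antidiagonal_swap]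
  simp only [coeff_pconj, star_mul, Prod.fst_swap, Prod.snd_swap]

lemma pconj_C (a : CoQ) : pconj (C a) = C (star a) := by
  ext1 n
  rw [coeff_pconj, coeff_C, coeff_C]
  split_ifs <;> simp only [star_zero]

lemma pconj_X : pconj X = X := by
  ext1 n
  rw [coeff_pconj, coeff_X]
  split_ifs <;> simp only [star_zero, star_one]

lemma commute_C_coe (r : ℝ) (F : Polynomial CoQ) : Commute (C (r : CoQ)) F := by
  ext1 n
  rw [coeff_C_mul, coeff_mul_C, QuaternionAlgebra.coe_commutes]

lemma commute_charPoly (q : CoQ) (F : Polynomial CoQ) : Commute (charPoly q) F :=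
  (((commute_X F).pow_left 2).sub_left ((commute_C_coe _ F).mul_left (commute_X F))).add_left
    (commute_C_coe _ F)

lemma pconj_charPoly (q : CoQ) : pconj (charPoly q) = charPoly q := by
  have hX (n : ℕ) : star ((X ^ 2 : Polynomial CoQ).coeff n) = (X ^ 2 : Polynomial CoQ).coeff n := by
    rw [coeff_X_pow]
    split_ifs <;> simp only [star_zero, star_one]
  have hC (r : ℝ) : pconj (C (r : CoQ)) = C (r : CoQ) := by
    rw [pconj_C, QuaternionAlgebra.star_coe]
  have hlin : pconj (C ((2 * q.re : ℝ) : CoQ) * X) = C ((2 * q.re : ℝ) : CoQ) * X := by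
    rw [pconj_mul, pconj_X, hC, X_mul_C]
  ext1 n
  rw [charPoly, pconj_add, hC, coeff_add, coeff_add, coeff_pconj, coeff_sub, star_sub, hX,
    ← coeff_pconj, hlin]

lemma charPoly_monic (q : CoQ) : (charPoly q).Monic := by
  unfold charPoly; monicity!

lemma charPoly_natDegree (q : CoQ) : (charPoly q).natDegree = 2 := by
  unfold charPoly; compute_degree!

lemma star_mul_self_eq_coDet (a : CoQ) : star a * a = ((coDet a : ℝ) : CoQ) := by
  ext <;> simp <;> (try unfold coDet) <;> ring

lemma mul_star_self_eq_coDet (a : CoQ) : a * star a = ((coDet a : ℝ) : CoQ) := by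
  ext <;> simp <;> (try unfold coDet) <;> ring

lemma coDet_mul (a b : CoQ) : coDet (a * b) = coDet a * coDet b := by
  simp [coDet]; ring

lemma coDet_star (a : CoQ) : coDet (star a) = coDet a := by
  simp [coDet]

lemma coDet_smul (r : ℝ) (a : CoQ) : coDet (r • a) = r ^ 2 * coDet a := by
  simp [coDet]; ring

lemma coDet_neg (a : CoQ) : coDet (-a) = coDet a := by
  simp [coDet]

lemma eval_charPoly_self (z : CoQ) : (charPoly z).eval z = 0 := by
  rw [charPoly, eval_add, eval_sub, eval_C, eval_C_mul, eval_X, eval_X_pow]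
  ext <;> simp [pow_two, -QuaternionAlgebra.coe_mul] <;> (try unfold coDet) <;> ring

lemma charPoly_congr {z q : CoQ} (hre : z.re = q.re) (hdet : coDet z = coDet q) :
    charPoly z = charPoly q := by
  rw [charPoly, charPoly, hre, hdet]

/-- The linear remainder governs evaluation on the quasi-similarity class of `q`. -/
lemma eval_mul_charPoly_add (Q : Polynomial CoQ) (A B : CoQ) {z q : CoQ} (hre : z.re = q.re)
    (hdet : coDet z = coDet q) : (Q * charPoly q + C B * X + C A).eval z = B * z + A := by
  have hcomm : ∀ k, Commute (RingHom.id CoQ ((charPoly z).coeff k)) z := fun k => by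
    have h := congrArg (coeff · k) (commute_charPoly z (C z)).eq
    rwa [coeff_mul_C, coeff_C_mul] at h
  rw [← charPoly_congr hre hdet, eval_add, eval_add, eval_C, eval_C_mul, eval_X, eval,
    eval₂_mul_noncomm _ _ hcomm, ← eval, ← eval, eval_charPoly_self, mul_zero, zero_add]

/-- Comparing coefficients when the characteristic polynomial divides the companion polynomial of
a linear polynomial. -/
lemma companion_linear_eq {q A B : CoQ} {S : Polynomial CoQ}
    (h : (X * C (star B) + C (star A)) * (C B * X + C A) = S * charPoly q) :
    (star B * A).re = - (coDet B * q.re) ∧ coDet A = coDet B * coDet q := by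
  have hexp : (X * C (star B) + C (star A)) * (C B * X + C A) =
      C ((coDet B : ℝ) : CoQ) * X ^ 2 + C (star B * A + star A * B) * X
        + C ((coDet A : ℝ) : CoQ) := by
    simp only [← star_mul_self_eq_coDet, C_mul, C_add, pow_two, add_mul, mul_add,
      mul_assoc, X_mul]
    abel
  set D := C (star B * A + star A * B + ((coDet B * (2 * q.re) : ℝ) : CoQ)) * X
    + C ((coDet A - coDet B * coDet q : ℝ) : CoQ) with hD
  have hDS : D = charPoly q * (S - C ((coDet B : ℝ) : CoQ)) := by
    rw [(commute_charPoly q _).eq, sub_mul, ← h, hexp, hD, charPoly]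
    simp only [C_add, C_sub, C_mul, QuaternionAlgebra.coe_mul, QuaternionAlgebra.coe_sub,
      mul_add, mul_sub, add_mul, mul_assoc]
    abel
  have hD0 : D = 0 := by
    by_contra hne
    refine (charPoly_monic q).not_dvd_of_natDegree_lt hne ?_ ⟨_, hDS⟩
    rw [charPoly_natDegree]
    exact lt_of_le_of_lt natDegree_linear_le one_lt_two
  have h1 := congrArg (fun p => (coeff p 1).re) hD0
  have h0 := congrArg (fun p => (coeff p 0).re) hD0
  simp [hD, coeff_C, -QuaternionAlgebra.coe_mul] at h1 h0
  constructor
  · simp; linarith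
  · linarith

/-- Case 1 (`B` nonsingular): if `P = Q Ψ_q + B x + A` with `det B ≠ 0` and `Ψ_q`
divides the companion polynomial of `P`, then `z₀ = -star B * A / det B = -B⁻¹ A`
is the unique zero of `P` quasi-similar to `q`. -/
theorem stmt_14 (P Q : Polynomial CoQ) (q A B : CoQ)
    (hP : P = Q * charPoly q + C B * X + C A)
    (hB : coDet B ≠ 0)
    (hadm : ∃ S : Polynomial CoQ, pconj P * P = S * charPoly q) :
    let z₀ : CoQ := -((coDet B)⁻¹ • (star B * A))
    z₀.re = q.re ∧ coDet z₀ = coDet q ∧ P.eval z₀ = 0 ∧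
      ∀ z : CoQ, z.re = q.re → coDet z = coDet q → P.eval z = 0 → z = z₀ := by
  intro z₀
  obtain ⟨S, hS⟩ := hadm
  set R := C B * X + C A with hR
  have hPR : P = Q * charPoly q + R := by rw [hP, add_assoc]
  have hRc : pconj R = X * C (star B) + C (star A) := by
    rw [hR, pconj_add, pconj_mul, pconj_C, pconj_C, pconj_X]
  obtain ⟨hre', hdet'⟩ : (star B * A).re = - (coDet B * q.re) ∧ coDet A = coDet B * coDet q := by
    apply companion_linear_eq (S := S - pconj Q * P - pconj R * Q)
    rw [← hRc, ← hR, sub_mul, sub_mul, ← hS]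
    have h1 : pconj P * P = pconj Q * P * charPoly q + pconj R * (Q * charPoly q) + pconj R * R := by
      nth_rewrite 1 [hPR]
      rw [pconj_add, pconj_mul, pconj_charPoly, add_mul, (commute_charPoly q _).eq, mul_assoc,
        (commute_charPoly q P).eq, mul_assoc, add_assoc, ← mul_add, ← hPR]
    rw [h1, mul_assoc (pconj R)]
    abel
  have hre : z₀.re = q.re := by
    simp only [z₀, QuaternionAlgebra.re_neg, QuaternionAlgebra.re_smul, hre', smul_eq_mul]
    field_simp
  have hdet : coDet z₀ = coDet q := by
    simp only [z₀, coDet_neg, coDet_smul, coDet_mul, coDet_star, hdet']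
    field_simp
  refine ⟨hre, hdet, ?_, fun z hzre hzdet hz => ?_⟩
  · rw [hP, eval_mul_charPoly_add Q A B hre hdet]
    simp only [z₀, mul_neg, mul_smul_comm, ← mul_assoc, mul_star_self_eq_coDet,
      QuaternionAlgebra.coe_mul_eq_smul, smul_smul, inv_mul_cancel₀ hB, one_smul, neg_add_cancel]
  · rw [hP, eval_mul_charPoly_add Q A B hzre hzdet] at hz
    simp only [z₀, eq_neg_of_add_eq_zero_right hz, mul_neg, smul_neg, neg_neg, ← mul_assoc,
      star_mul_self_eq_coDet, QuaternionAlgebra.coe_mul_eq_smul, smul_smul, inv_mul_cancel₀ hB,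
      one_smul]
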